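/- Let R be a commutative ring and g ≥ 3 an integer. Consider V = R^g with the standard left action of GL_g(R). Then the coinvariants of the diagonal GL_g(R)-action on the abelian group V ⊗_ℤ V vanish: [V ⊗_ℤ V]_{GL_g(R)} = 0. The same holds when GL_g(R) acts on both factors by the dual (inverse-transpose) representation on (R^g)^∨. -/

import Mathlib

open TensorProduct Matrix

/-- If every pair `x, y` of additive generators of `V` admits an element `f` of a set `G` of
endomorphisms fixing `y` and sending some `z` to `z + x`, then the differences
`m - (f ⊗ f) m` generate `V ⊗ V`. -/
theorem subsingleton_tensor_quotient_of_exists_add {ι V : Type*} [AddCommGroup V]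
    (f : ι → V →ₗ[ℤ] V) (s : Set V) (hs : AddSubgroup.closure s = ⊤)
    (hf : ∀ x ∈ s, ∀ y ∈ s, ∃ a z, f a z = z + x ∧ f a y = y) :
    Subsingleton ((V ⊗[ℤ] V) ⧸ AddSubgroup.closure {x : V ⊗[ℤ] V |
      ∃ (a : ι) (m : V ⊗[ℤ] V), x = m - TensorProduct.map (f a) (f a) m}) := by
  rw [QuotientAddGroup.subsingleton_iff, eq_top_iff]
  set S := AddSubgroup.closure {x : V ⊗[ℤ] V |
    ∃ (a : ι) (m : V ⊗[ℤ] V), x = m - TensorProduct.map (f a) (f a) m}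
  have hgen : ∀ x ∈ s, ∀ y ∈ s, x ⊗ₜ[ℤ] y ∈ S := by
    intro x hx y hy
    obtain ⟨a, z, hz, hay⟩ := hf x hx y hy
    have h : z ⊗ₜ[ℤ] y - TensorProduct.map (f a) (f a) (z ⊗ₜ[ℤ] y) ∈ S :=
      AddSubgroup.subset_closure ⟨a, _, rfl⟩
    rw [TensorProduct.map_tmul, hz, hay, TensorProduct.add_tmul, sub_add_cancel_left] at h
    exact neg_mem_iff.mp h
  have hleft : ∀ x ∈ s, ∀ y, x ⊗ₜ[ℤ] y ∈ S := by
    intro x hx y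
    have hy : y ∈ AddSubgroup.closure s := hs ▸ AddSubgroup.mem_top y
    induction hy using AddSubgroup.closure_induction with
    | mem y hy => exact hgen x hx y hy
    | zero => rw [TensorProduct.tmul_zero]; exact S.zero_mem
    | add y y' _ _ h h' => rw [TensorProduct.tmul_add]; exact S.add_mem h h'
    | neg y _ h => rw [TensorProduct.tmul_neg]; exact S.neg_mem h
  have htmul : ∀ x y, x ⊗ₜ[ℤ] y ∈ S := by
    intro x y
    have hx : x ∈ AddSubgroup.closure s := hs ▸ AddSubgroup.mem_top x
    induction hx using AddSubgroup.closure_induction with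
    | mem x hx => exact hleft x hx y
    | zero => rw [TensorProduct.zero_tmul]; exact S.zero_mem
    | add x x' _ _ h h' => rw [TensorProduct.add_tmul]; exact S.add_mem h h'
    | neg x _ h => rw [TensorProduct.neg_tmul]; exact S.neg_mem h
  intro t _
  induction t using TensorProduct.induction_on with
  | zero => exact S.zero_mem
  | tmul x y => exact htmul x y
  | add a b ha hb => exact S.add_mem (ha trivial) (hb trivial)

theorem Fin.exists_ne_ne_of_three_le {g : ℕ} (hg : 3 ≤ g) (i j : Fin g) :
    ∃ k, k ≠ i ∧ k ≠ j := by
  have hcard : ({i, j} : Finset (Fin g)).card < (Finset.univ : Finset (Fin g)).card := by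
    rw [Finset.card_univ, Fintype.card_fin]
    exact Finset.card_le_two.trans_lt hg
  obtain ⟨k, -, hk⟩ := Finset.exists_mem_notMem_of_card_lt_card hcard
  exact ⟨k, by simpa using hk⟩

theorem Matrix.transvection_mulVec {n R : Type*} [Fintype n] [DecidableEq n] [CommRing R]
    (i j : n) (c : R) (v : n → R) :
    transvection i j c *ᵥ v = v + Pi.single i (c * v j) := by
  rw [transvection, add_mulVec, one_mulVec, single_mulVec]
  rfl

theorem Matrix.exists_coe_eq_transvection {n R : Type*} [Fintype n] [DecidableEq n] [CommRing R]
    {i j : n} (h : i ≠ j) (c : R) : ∃ A : GL n R, (A : Matrix n n R) = transvection i j c :=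
  ⟨GeneralLinearGroup.mk'' (transvection i j c) (by rw [det_transvection_of_ne i j h c]; exact isUnit_one), rfl⟩

theorem AddSubgroup.closure_range_single {n R : Type*} [Fintype n] [DecidableEq n]
    [AddCommGroup R] :
    AddSubgroup.closure (Set.range fun p : n × R => (Pi.single p.1 p.2 : n → R)) = ⊤ := by
  refine eq_top_iff.mpr fun v _ => ?_
  rw [← Finset.univ_sum_single v]
  exact sum_mem fun i _ => AddSubgroup.subset_closure ⟨(i, v i), rfl⟩

theorem AddSubgroup.closure_range_smul_proj {n R : Type*} [Fintype n] [DecidableEq n]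
    [CommRing R] :
    AddSubgroup.closure
      (Set.range fun p : n × R => (p.2 • LinearMap.proj p.1 : Module.Dual R (n → R))) = ⊤ := by
  refine eq_top_iff.mpr fun φ _ => ?_
  have h : φ = ∑ i, φ (Pi.single i 1) • (LinearMap.proj i : Module.Dual R (n → R)) := by
    refine LinearMap.pi_ext' fun i => LinearMap.ext_ring ?_
    simp [Pi.single_apply]
  rw [h]
  exact sum_mem fun i _ => AddSubgroup.subset_closure ⟨(i, φ (Pi.single i 1)), rfl⟩

/-- For a commutative ring `R` and `g ≥ 3`, the coinvariants of the diagonal action of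
`GL_g(R)` on `V ⊗_ℤ V`, for `V = R^g` the standard representation, vanish; the same
holds for the dual (inverse-transpose) representation on `V^∨ = Hom_R(R^g, R)`. -/
theorem coinvariants_tensor_square_standard_rep_eq_top
    {R : Type*} [CommRing R] (g : ℕ) (hg : 3 ≤ g) :
    Subsingleton (((Fin g → R) ⊗[ℤ] (Fin g → R)) ⧸
      AddSubgroup.closure {x : (Fin g → R) ⊗[ℤ] (Fin g → R) |
        ∃ (A : GL (Fin g) R) (m : (Fin g → R) ⊗[ℤ] (Fin g → R)),
          x = m - TensorProduct.map
            ((Matrix.mulVecLin (A : Matrix (Fin g) (Fin g) R)).toAddMonoidHom.toIntLinearMap)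
            ((Matrix.mulVecLin (A : Matrix (Fin g) (Fin g) R)).toAddMonoidHom.toIntLinearMap)
            m}) ∧
    Subsingleton ((Module.Dual R (Fin g → R) ⊗[ℤ] Module.Dual R (Fin g → R)) ⧸
      AddSubgroup.closure {x : Module.Dual R (Fin g → R) ⊗[ℤ] Module.Dual R (Fin g → R) |
        ∃ (A : GL (Fin g) R) (m : Module.Dual R (Fin g → R) ⊗[ℤ] Module.Dual R (Fin g → R)),
          x = m - TensorProduct.map
            ((LinearMap.lcomp R R
              (Matrix.mulVecLin ((A⁻¹ : GL (Fin g) R) : Matrix (Fin g) (Fin g) R))).toAddMonoidHom.toIntLinearMap)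
            ((LinearMap.lcomp R R
              (Matrix.mulVecLin ((A⁻¹ : GL (Fin g) R) : Matrix (Fin g) (Fin g) R))).toAddMonoidHom.toIntLinearMap)
            m}) := by
  constructor
  · refine subsingleton_tensor_quotient_of_exists_add
      (fun A : GL (Fin g) R => (Matrix.mulVecLin
        (A : Matrix (Fin g) (Fin g) R)).toAddMonoidHom.toIntLinearMap)
      _ AddSubgroup.closure_range_single ?_
    rintro _ ⟨⟨i, r⟩, rfl⟩ _ ⟨⟨j, s⟩, rfl⟩
    obtain ⟨k, hki, hkj⟩ := Fin.exists_ne_ne_of_three_le hg i j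
    obtain ⟨A, hA⟩ := Matrix.exists_coe_eq_transvection hki.symm (1 : R)
    refine ⟨A, Pi.single k r, ?_, ?_⟩
    · change (A : Matrix (Fin g) (Fin g) R) *ᵥ _ = _
      rw [hA, Matrix.transvection_mulVec]
      simp
    · change (A : Matrix (Fin g) (Fin g) R) *ᵥ _ = _
      rw [hA, Matrix.transvection_mulVec]
      simp [hkj]
  · refine subsingleton_tensor_quotient_of_exists_add
      (fun A : GL (Fin g) R => (LinearMap.lcomp R R (Matrix.mulVecLin
        ((A⁻¹ : GL (Fin g) R) : Matrix (Fin g) (Fin g) R))).toAddMonoidHom.toIntLinearMap)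
      _ AddSubgroup.closure_range_smul_proj ?_
    rintro _ ⟨⟨i, r⟩, rfl⟩ _ ⟨⟨j, s⟩, rfl⟩
    obtain ⟨k, hki, hkj⟩ := Fin.exists_ne_ne_of_three_le hg i j
    obtain ⟨A, hA⟩ := Matrix.exists_coe_eq_transvection hki (1 : R)
    refine ⟨A⁻¹, r • LinearMap.proj k, LinearMap.ext fun v => ?_, LinearMap.ext fun v => ?_⟩
    · change r * (((A⁻¹⁻¹ : GL (Fin g) R) : Matrix (Fin g) (Fin g) R) *ᵥ v) k = r * v k + r * v i
      rw [inv_inv, hA, Matrix.transvection_mulVec]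
      simp [mul_add]
    · change s * (((A⁻¹⁻¹ : GL (Fin g) R) : Matrix (Fin g) (Fin g) R) *ᵥ v) j = s * v j
      rw [inv_inv, hA, Matrix.transvection_mulVec]
      simp [hkj.symm]
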